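/- (Shchigolev's conjecture) Let $p > 2$ be a prime and $k$ a field of characteristic $p$. For any strictly increasing sequence $I = (i_j)_{j\geq 1}$ of positive integers, the $T$-space $L_{\infty,I}$ of $k_0\langle X\rangle$ generated by the set $\{x_1^p x_2^p \cdots x_{i_j}^p : j \geq 1\}$ is finitely based, with a $T$-space basis of size at most $i_2 - i_1 + 1$. In particular, every infinite subset of $\{x_1^p, x_1^p x_2^p, x_1^p x_2^p x_3^p, \ldots\}$ generates a finitely based $T$-space. -/

import Mathlib

open scoped BigOperators

/-- The free non-unital associative algebra over `k` on countably many variables,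
realized as the semigroup algebra of the free semigroup on `ℕ`. -/
abbrev FA (k : Type*) [Field k] := MonoidAlgebra k (FreeSemigroup ℕ)

/-- The generator (variable) `x_i`. -/
noncomputable def Xg (k : Type*) [Field k] (i : ℕ) : FA k :=
  MonoidAlgebra.single (FreeSemigroup.of i) 1

/-- Product of a (nonempty) list in a non-unital semiring; `0` on the empty list. -/
def lprod {A : Type*} [NonUnitalSemiring A] : List A → A
  | [] => 0
  | [a] => a
  | a :: b :: l => a * lprod (b :: l)

/-- `n`-th power in a non-unital semiring (zero for `n = 0`). -/
def npow' {A : Type*} [NonUnitalSemiring A] (a : A) (n : ℕ) : A :=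
  lprod (List.replicate n a)

/-- The full multilinear symmetrization `S^{(d)}(y_1,…,y_d) = ∑_{σ ∈ Σ_d} y_{σ(1)} ⋯ y_{σ(d)}`. -/
def Ssym {A : Type*} [NonUnitalSemiring A] (d : ℕ) (y : Fin d → A) : A :=
  ∑ σ : Equiv.Perm (Fin d), lprod (List.ofFn (fun i => y (σ i)))

/-- A T-space: a subspace closed under all substitution endomorphisms
(non-unital algebra endomorphisms). -/
def IsTSpace (k : Type*) [Field k] (V : Submodule k (FA k)) : Prop :=
  ∀ (φ : FA k →ₙₐ[k] FA k), ∀ v ∈ V, φ v ∈ V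

/-- The T-space generated by a set `S`: the span of all substitution instances
of elements of `S`. -/
noncomputable def TSpan (k : Type*) [Field k] (S : Set (FA k)) : Submodule k (FA k) :=
  Submodule.span k {a | ∃ (φ : FA k →ₙₐ[k] FA k) (s : FA k), s ∈ S ∧ a = φ s}

/-- The set of products `u * v` with `u ∈ U`, `v ∈ V`. -/
def mulSet {k : Type*} [Field k] (U V : Submodule k (FA k)) : Set (FA k) :=
  {a | ∃ u ∈ U, ∃ v ∈ V, a = u * v}

/-- The T-spaces `S_n^{(d)}`: `S_1^{(d)}` is generated by `S^{(d)}(x_1,…,x_d)` and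
`S_{n+1}^{(d)} = (S_n^{(d)} S_1^{(d)})^S`. -/
noncomputable def Sn (k : Type*) [Field k] (d : ℕ) : ℕ → Submodule k (FA k)
  | 0 => ⊥
  | 1 => TSpan k {Ssym d (fun i => Xg k i)}
  | (n+2) => TSpan k (mulSet (Sn k d (n+1)) (Sn k d 1))

/-- The T-spaces `H_n`: `H_1` is generated by `x_1^p` and `H_{n+1} = (H_n H_1)^S`. -/
noncomputable def Hn (k : Type*) [Field k] (p : ℕ) : ℕ → Submodule k (FA k)
  | 0 => ⊥
  | 1 => TSpan k {npow' (Xg k 0) p}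
  | (n+2) => TSpan k (mulSet (Hn k p (n+1)) (Hn k p 1))

/-- The word `x_1^p x_2^p ⋯ x_n^p`. -/
noncomputable def hword (k : Type*) [Field k] (p n : ℕ) : FA k :=
  lprod ((List.range n).map (fun t => npow' (Xg k t) p))

section Trace

variable {k R : Type*} [Field k] [Ring R] [Algebra k R]

/-- The inner derivation `x ↦ a * x - x * a`. -/
def innerDer (k : Type*) {R : Type*} [Field k] [Ring R] [Algebra k R] (a : R) : Module.End k R :=
  LinearMap.mulLeft k a - LinearMap.mulRight k a

theorem innerDer_apply (a x : R) : innerDer k a x = a * x - x * a := by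
  simp [innerDer]

theorem innerDer_mul (a x y : R) :
    innerDer k a (x * y) = innerDer k a x * y + x * innerDer k a y := by
  simp only [innerDer_apply]
  noncomm_ring

theorem innerDer_mem {A : NonUnitalSubalgebra k R} {a x : R} (ha : a ∈ A) (hx : x ∈ A) :
    innerDer k a x ∈ A := by
  rw [innerDer_apply]
  exact sub_mem (mul_mem ha hx) (mul_mem hx ha)

theorem innerDer_pow_mem {A : NonUnitalSubalgebra k R} {a x : R} (ha : a ∈ A) (hx : x ∈ A)
    (n : ℕ) : (innerDer k a ^ n) x ∈ A := by
  induction n with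
  | zero => simpa using hx
  | succ n ih => rw [pow_succ', Module.End.mul_apply]; exact innerDer_mem ha ih

/-- `W` is a subspace of `A` that is stable under the inner derivations of `A`, and the functional
`f` does not change when an element of `W` is moved cyclically. -/
structure IsTraceModule (f : R →ₗ[k] k) (A : NonUnitalSubalgebra k R) (W : Submodule k R) :
    Prop where
  mem_of_mem : ∀ w ∈ W, w ∈ A
  der_mem : ∀ a ∈ A, ∀ w ∈ W, innerDer k a w ∈ W
  apply_comm : ∀ a ∈ A, ∀ w ∈ W, f (a * w) = f (w * a)

namespace IsTraceModule

variable {f : R →ₗ[k] k} {A : NonUnitalSubalgebra k R} {W V : Submodule k R}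

theorem der_pow_mem (hW : IsTraceModule f A W) {a w : R} (ha : a ∈ A) (hw : w ∈ W) (n : ℕ) :
    (innerDer k a ^ n) w ∈ W := by
  induction n with
  | zero => simpa using hw
  | succ n ih => rw [pow_succ', Module.End.mul_apply]; exact hW.der_mem a ha _ ih

theorem apply_mul_der_swap (hW : IsTraceModule f A W) {x y w : R} (hx : x ∈ A) (hy : y ∈ A)
    (hw : w ∈ W) : f (x * innerDer k y w) = -f (y * innerDer k x w) := by
  have h₁ := hW.apply_comm (x * y) (mul_mem hx hy) w hw
  have h₂ := hW.apply_comm y hy _ (hW.der_mem x hx w hw)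
  simp only [innerDer_apply, mul_sub, sub_mul, map_sub, mul_assoc] at *
  linear_combination h₁ + h₂

theorem apply_der_mul_der (h2 : (2 : k) ≠ 0) (hW : IsTraceModule f A W) {a c w : R}
    (ha : a ∈ A) (hc : c ∈ A) (hw : w ∈ W) :
    f (innerDer k a (c * innerDer k a w)) = 0 := by
  have h₁ := hW.apply_mul_der_swap (mul_mem ha hc) ha hw
  have h₂ := hW.apply_mul_der_swap ha hc (hW.der_mem a ha w hw)
  have h₃ := hW.apply_mul_der_swap (mul_mem ha ha) hc hw
  refine (mul_eq_zero.1 (?_ : (2 : k) * _ = 0)).resolve_left h2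
  simp only [innerDer_apply, mul_sub, map_sub, mul_assoc] at *
  linear_combination h₁ + h₂ - h₃

theorem apply_der_pow_succ_mul (h2 : (2 : k) ≠ 0) (hW : IsTraceModule f A W) {a c w : R}
    (ha : a ∈ A) (hc : c ∈ A) (hw : w ∈ W) (n : ℕ) :
    f ((innerDer k a ^ (n + 1)) (c * w)) = f (innerDer k a ((innerDer k a ^ n) c * w)) := by
  induction n generalizing c w with
  | zero => simp
  | succ n ih =>
    rw [pow_succ, Module.End.mul_apply, innerDer_mul, map_add, map_add, ih (innerDer_mem ha hc) hw,
      ih hc (hW.der_mem a ha w hw), hW.apply_der_mul_der h2 ha (innerDer_pow_mem ha hc n) hw,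
      add_zero, ← Module.End.mul_apply (innerDer k a ^ n), ← pow_succ]

theorem apply_der_pow_mul_der (h2 : (2 : k) ≠ 0) (hW : IsTraceModule f A W) {a c w : R}
    (ha : a ∈ A) (hc : c ∈ A) (hw : w ∈ W) (n : ℕ) :
    f ((innerDer k a ^ n) c * innerDer k a w) = (-1) ^ n * f (c * (innerDer k a ^ (n + 1)) w) := by
  induction n generalizing w with
  | zero => simp
  | succ n ih =>
    have h := hW.apply_der_mul_der h2 ha (innerDer_pow_mem ha hc n) hw
    rw [innerDer_mul, map_add, ih (hW.der_mem a ha w hw), ← Module.End.mul_apply,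
      ← Module.End.mul_apply (innerDer k a ^ (n + 1)), ← pow_succ, ← pow_succ'] at h
    rw [pow_succ (-1 : k)]
    linear_combination h

/-- Integration by parts for an even power of an inner derivation, for a functional vanishing on
the values of that power. -/
theorem apply_der_pow_mul (h2 : (2 : k) ≠ 0) (hW : IsTraceModule f A W) {n : ℕ} (hn : Odd n)
    {a c w : R} (ha : a ∈ A) (hc : c ∈ A) (hw : w ∈ W)
    (h0 : f ((innerDer k a ^ (n + 1)) (c * w)) = 0) :
    f ((innerDer k a ^ (n + 1)) c * w) = f (c * (innerDer k a ^ (n + 1)) w) := by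
  rw [hW.apply_der_pow_succ_mul h2 ha hc hw, innerDer_mul, map_add,
    hW.apply_der_pow_mul_der h2 ha hc hw, hn.neg_one_pow, ← Module.End.mul_apply, ← pow_succ'] at h0
  linear_combination h0

theorem mul (hW : IsTraceModule f A W) (hV : IsTraceModule f A V) :
    IsTraceModule f A (W * V) where
  mem_of_mem u hu := by
    refine Submodule.mul_induction_on hu (fun w hw v hv => ?_) fun x y hx hy => add_mem hx hy
    exact mul_mem (hW.mem_of_mem w hw) (hV.mem_of_mem v hv)
  der_mem a ha u hu := by
    refine Submodule.mul_induction_on hu (fun w hw v hv => ?_) fun x y hx hy => ?_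
    · rw [innerDer_mul]
      exact add_mem (Submodule.mul_mem_mul (hW.der_mem a ha w hw) hv)
        (Submodule.mul_mem_mul hw (hV.der_mem a ha v hv))
    · rw [map_add]
      exact add_mem hx hy
  apply_comm a ha u hu := by
    refine Submodule.mul_induction_on hu (fun w hw v hv => ?_) fun x y hx hy => ?_
    · rw [← mul_assoc, hV.apply_comm _ (mul_mem ha (hW.mem_of_mem w hw)) v hv, ← mul_assoc,
        hW.apply_comm _ (mul_mem (hV.mem_of_mem v hv) ha) w hw, mul_assoc]
    · rw [mul_add, map_add, hx, hy, add_mul, map_add]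

/-- Two trace modules that commute under `f` from the left have vanishing mixed second
derivatives. -/
theorem apply_mul_der_mul_der (h2 : (2 : k) ≠ 0) (hW : IsTraceModule f A W)
    (hV : IsTraceModule f A V)
    (hWV : ∀ x ∈ A, ∀ w ∈ W, ∀ v ∈ V, f (x * (w * v)) = f (x * (v * w)))
    {a y w v : R} (ha : a ∈ A) (hy : y ∈ A) (hw : w ∈ W) (hv : v ∈ V) :
    f (y * (innerDer k a w * innerDer k a v)) = 0 := by
  have key : ∀ x ∈ A, ∀ z ∈ A, ∀ w ∈ W, ∀ v ∈ V, f (x * (w * v) * z) = f (x * (v * w) * z) := by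
    intro x hx z hz w hw v hv
    have h₁ := hWV (x * z) (mul_mem hx hz) w hw v hv
    have h₂ := hWV x hx _ (hW.der_mem z hz w hw) v hv
    have h₃ := hWV x hx w hw _ (hV.der_mem z hz v hv)
    simp only [innerDer_apply, mul_sub, sub_mul, map_sub, mul_assoc] at *
    linear_combination h₁ - h₂ - h₃
  have hw1 := hW.der_mem a ha w hw
  have hv1 := hV.der_mem a ha v hv
  have hw2 := hW.der_mem y hy w hw
  have hwA := hW.mem_of_mem _ hw2
  have hvA := hV.mem_of_mem _ hv1
  have e₁ := hV.apply_comm (y * innerDer k a w) (mul_mem hy (hW.mem_of_mem _ hw1)) _ hv1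
  have e₂ := hW.apply_mul_der_swap (mul_mem hvA hy) ha hw
  have e₃ := key a ha y hy w hw _ hv1
  have e₄ := hW.apply_comm (a * innerDer k a v) (mul_mem ha hvA) _ hw2
  have e₅ := hV.apply_mul_der_swap (mul_mem hwA ha) ha hv
  have e₆ := key a ha a ha _ hw2 v hv
  have e₇ := hWV a ha _ hw2 _ hv1
  have hz : (2 : k) * f (y * (innerDer k a w * innerDer k a v)) = 0 := by
    have s₁ : f (y * (innerDer k a w * innerDer k a v)) =
        -f (a * (innerDer k a v * innerDer k y w)) := by
      generalize innerDer k a v = v' at *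
      simp only [innerDer_apply, mul_sub, sub_mul, map_sub, mul_assoc] at *
      linear_combination e₁ + e₂ + e₃
    have s₂ : f (a * (innerDer k a v * innerDer k y w)) =
        -f (a * (innerDer k y w * innerDer k a v)) := by
      generalize innerDer k y w = w' at *
      simp only [innerDer_apply, mul_sub, sub_mul, map_sub, mul_assoc] at *
      linear_combination e₄ + e₅ - e₆
    linear_combination 2 * s₁ - s₂ + e₇
  exact (mul_eq_zero.1 hz).resolve_left h2

theorem apply_mul_der_pow_mul (h2 : (2 : k) ≠ 0) (hW : IsTraceModule f A W)
    (hV : IsTraceModule f A V)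
    (hWV : ∀ x ∈ A, ∀ w ∈ W, ∀ v ∈ V, f (x * (w * v)) = f (x * (v * w)))
    {a y w v : R} (ha : a ∈ A) (hy : y ∈ A) (hw : w ∈ W) (hv : v ∈ V) (n : ℕ) :
    f (y * (innerDer k a ^ (n + 1)) (w * v)) =
      f (y * ((innerDer k a ^ (n + 1)) w * v)) + f (y * (w * (innerDer k a ^ (n + 1)) v)) := by
  induction n generalizing w v with
  | zero => simp [innerDer_mul, mul_add]
  | succ n ih =>
    have h₁ := hW.apply_mul_der_mul_der h2 hV hWV ha hy hw (hV.der_pow_mem ha hv n)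
    have h₂ := hW.apply_mul_der_mul_der h2 hV hWV ha hy (hW.der_pow_mem ha hw n) hv
    simp only [← Module.End.mul_apply, ← pow_succ'] at h₁ h₂
    rw [pow_succ, Module.End.mul_apply, innerDer_mul, map_add, mul_add, map_add,
      ih (hW.der_mem a ha w hw) hv, ih hw (hV.der_mem a ha v hv), h₁, h₂]
    simp only [← Module.End.mul_apply, ← pow_succ, zero_add, add_zero]

theorem apply_der_pow_mul_mul (h2 : (2 : k) ≠ 0) (hW : IsTraceModule f A W)
    (hV : IsTraceModule f A V)
    (hWV : ∀ x ∈ A, ∀ w ∈ W, ∀ v ∈ V, f (x * (w * v)) = f (x * (v * w))) {n : ℕ} (hn : Odd n)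
    {a : R} (ha : a ∈ A) (h0 : ∀ x ∈ A, f ((innerDer k a ^ (n + 1)) x) = 0)
    (h0W : ∀ x ∈ A, ∀ w ∈ W, f ((innerDer k a ^ (n + 1)) x * w) = 0)
    (h0V : ∀ x ∈ A, ∀ v ∈ V, f ((innerDer k a ^ (n + 1)) x * v) = 0)
    {y w v : R} (hy : y ∈ A) (hw : w ∈ W) (hv : v ∈ V) :
    f ((innerDer k a ^ (n + 1)) y * (w * v)) = 0 := by
  have hwA := hW.mem_of_mem _ hw
  have hvA := hV.mem_of_mem _ hv
  have hDw := hW.der_pow_mem ha hw (n + 1)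
  rw [(hW.mul hV).apply_der_pow_mul h2 hn ha hy (Submodule.mul_mem_mul hw hv)
      (h0 _ (mul_mem hy (mul_mem hwA hvA))), hW.apply_mul_der_pow_mul h2 hV hWV ha hy hw hv,
    ← mul_assoc, ← mul_assoc,
    hV.apply_comm _ (mul_mem hy (hW.mem_of_mem _ hDw)) v hv, ← mul_assoc,
    ← hW.apply_der_pow_mul h2 hn ha (mul_mem hvA hy) hw (h0 _ (mul_mem (mul_mem hvA hy) hwA)),
    ← hV.apply_der_pow_mul h2 hn ha (mul_mem hy hwA) hv (h0 _ (mul_mem (mul_mem hy hwA) hvA)),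
    h0W _ (mul_mem hvA hy) w hw, h0V _ (mul_mem hy hwA) v hv, add_zero]

end IsTraceModule

end Trace

section PowSpan

variable {k R : Type*} [Field k] [Ring R] [Algebra k R]

theorem cast_choose_prime_sub_one (k : Type*) [Ring k] {p : ℕ} (hp : p.Prime) [CharP k p] {i : ℕ}
    (hi : i < p) : ((p - 1).choose i : k) = (-1) ^ i := by
  induction i with
  | zero => simp
  | succ i ih =>
    have h : (p.choose (i + 1) : k) = 0 :=
      (CharP.cast_eq_zero_iff k p _).2 (hp.dvd_choose_self (Nat.succ_ne_zero i) hi)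
    obtain ⟨q, rfl⟩ : ∃ q, p = q + 1 := ⟨p - 1, by omega⟩
    rw [Nat.choose_succ_succ, Nat.cast_add] at h
    rw [Nat.add_sub_cancel] at ih ⊢
    rw [ih (by omega)] at h
    rw [pow_succ, mul_neg_one, eq_neg_iff_add_eq_zero, add_comm]
    exact h

theorem charP_end (p : ℕ) [CharP k p] [Nontrivial R] : CharP (Module.End k R) p :=
  charP_of_injective_algebraMap (algebraMap k (Module.End k R)).injective p

theorem innerDer_pow_char {p : ℕ} (hp : p.Prime) [CharP k p] [Nontrivial R] (a : R) :
    innerDer k a ^ p = innerDer k (a ^ p) := by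
  have := Fact.mk hp
  have : CharP (Module.End k R) p := charP_end p
  rw [innerDer, sub_pow_char_of_commute p (LinearMap.commute_mulLeft_right (R := k) a a),
    LinearMap.pow_mulLeft, LinearMap.pow_mulRight, innerDer]

theorem innerDer_pow_char_sub_one {p : ℕ} (hp : p.Prime) (hp2 : 2 < p) [CharP k p] [Nontrivial R]
    (a y : R) :
    (innerDer k a ^ (p - 1)) y = ∑ i ∈ Finset.range p, a ^ i * y * a ^ (p - 1 - i) := by
  have : CharP (Module.End k R) p := charP_end p
  have hone : (-1 : Module.End k R) ^ (p - 1) = 1 :=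
    Even.neg_one_pow (α := Module.End k R) (hp.even_sub_one (by omega))
  rw [innerDer, sub_eq_add_neg,
    ((LinearMap.commute_mulLeft_right (R := k) a a).neg_right).add_pow, Nat.sub_add_cancel hp.one_le,
    LinearMap.sum_apply]
  refine Finset.sum_congr rfl fun i hi => ?_
  have hi := Finset.mem_range.1 hi
  rw [cast_choose_prime_sub_one _ hp hi, neg_pow, mul_assoc, mul_assoc,
    (Commute.neg_one_left _).pow_left _ |>.eq, mul_assoc, ← pow_add, Nat.add_sub_cancel' (by omega),
    hone, mul_one, LinearMap.pow_mulLeft, LinearMap.pow_mulRight, Module.End.mul_apply,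
    LinearMap.mulLeft_apply, LinearMap.mulRight_apply, mul_assoc]

/-- Vandermonde interpolation: coefficients of a polynomial of degree less than `p` lie in every
subspace containing its values on the prime field. -/
theorem mem_of_sum_pow_smul_mem {p : ℕ} [CharP k p] (N : Submodule k R) (c : ℕ → R)
    (h : ∀ t : ℕ, ∑ i ∈ Finset.range p, (t : k) ^ i • c i ∈ N) {i : ℕ} (hi : i < p) : c i ∈ N := by
  by_contra hc
  obtain ⟨f, hf, hN⟩ := Submodule.exists_le_ker_of_notMem hc
  have hinj : Function.Injective fun j : Fin p => ((j : ℕ) : k) := fun x y hxy =>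
    Fin.ext (CharP.natCast_injOn_Iio k p x.2 y.2 hxy)
  have hz := Matrix.eq_zero_of_forall_index_sum_mul_pow_eq_zero (v := fun j : Fin p => f (c j)) hinj
    fun j => by
      have := hN (h j)
      rw [LinearMap.mem_ker, map_sum, Finset.sum_range] at this
      simpa [mul_comm] using this
  exact hf (congrFun hz ⟨i, hi⟩)

/-- The span of the `p`-th powers of elements of `A`. -/
def powSpan (A : NonUnitalSubalgebra k R) (p : ℕ) : Submodule k R :=
  Submodule.span k ((fun a => a ^ p) '' (A : Set R))

/-- The span of the values of the `(p - 1)`-st powers of inner derivations of `A`. -/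
def derSpan (A : NonUnitalSubalgebra k R) (p : ℕ) : Submodule k R :=
  Submodule.span k {x | ∃ a ∈ A, ∃ y ∈ A, x = (innerDer k a ^ (p - 1)) y}

variable {A : NonUnitalSubalgebra k R} {p : ℕ}

theorem pow_mem_powSpan {a : R} (ha : a ∈ A) : a ^ p ∈ powSpan A p :=
  Submodule.subset_span ⟨a, ha, rfl⟩

theorem innerDer_pow_mem_derSpan {a y : R} (ha : a ∈ A) (hy : y ∈ A) :
    (innerDer k a ^ (p - 1)) y ∈ derSpan A p :=
  Submodule.subset_span ⟨a, ha, y, hy, rfl⟩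

open Polynomial in
theorem derivative_pow_noncomm (Q : R[X]) (n : ℕ) :
    derivative (Q ^ n) = ∑ i ∈ Finset.range n, Q ^ i * derivative Q * Q ^ (n - 1 - i) := by
  induction n with
  | zero => simp
  | succ n ih =>
    rw [pow_succ, derivative_mul, ih, Finset.sum_range_succ, Finset.sum_mul]
    congr 1
    · refine Finset.sum_congr rfl fun i hi => ?_
      have hi := Finset.mem_range.1 hi
      rw [mul_assoc, ← pow_succ]
      congr 2
      omega
    · simp

open Polynomial in
/-- Evaluation of polynomials with non-commuting coefficients at a scalar. -/
noncomputable def evalScalar (t : k) : R[X] →+* R :=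
  eval₂RingHom' (RingHom.id R) (algebraMap k R t) fun a => (Algebra.commutes t a).symm

open Polynomial in
theorem evalScalar_eq_sum (t : k) (Q : R[X]) {n : ℕ} (hn : Q.natDegree < n) :
    evalScalar t Q = ∑ i ∈ Finset.range n, t ^ i • Q.coeff i := by
  change eval₂ (RingHom.id R) (algebraMap k R t) Q = _
  rw [eval₂_eq_sum_range' _ hn]
  refine Finset.sum_congr rfl fun i _ => ?_
  rw [Algebra.smul_def, Algebra.commutes, map_pow, RingHom.id_apply]

open Polynomial in
theorem evalScalar_line (t : k) (a y : R) : evalScalar t (C a + X * C y) = a + t • y := by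
  simp [evalScalar, Algebra.smul_def, eval₂RingHom', Algebra.commutes]

open Polynomial in
theorem natDegree_line_pow_le (a y : R) (n : ℕ) : ((C a + X * C y) ^ n).natDegree ≤ n := by
  refine (natDegree_pow_le_of_le (m := 1) n ?_).trans_eq (mul_one n)
  compute_degree

open Polynomial in
theorem coeff_line_pow (a y : R) (n : ℕ) : ((C a + X * C y) ^ n).coeff n = y ^ n := by
  have := coeff_pow_of_natDegree_le (p := (C a + X * C y : R[X])) (n := 1) (m := n)
    (by compute_degree)
  simpa using this

open Polynomial in
theorem evalScalar_derivative_line_pow (hp : p.Prime) (hp2 : 2 < p) [CharP k p] [Nontrivial R]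
    (t : k) (a y : R) : evalScalar t (derivative ((C a + X * C y) ^ p)) =
      (innerDer k (a + t • y) ^ (p - 1)) y := by
  have hC : evalScalar t (C y) = y := eval₂_C _ _
  rw [innerDer_pow_char_sub_one hp hp2, derivative_pow_noncomm, map_sum]
  refine Finset.sum_congr rfl fun i _ => ?_
  rw [map_mul, map_mul, map_pow, map_pow, evalScalar_line]
  simp [hC]

open Polynomial in
theorem derSpan_le_powSpan (hp : p.Prime) (hp2 : 2 < p) [CharP k p] [Nontrivial R] :
    derSpan A p ≤ powSpan A p := by
  refine Submodule.span_le.2 ?_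
  rintro _ ⟨a, ha, y, hy, rfl⟩
  have hc : ((C a + X * C y : R[X]) ^ p).coeff p = y ^ p := coeff_line_pow a y p
  have h1 := mem_of_sum_pow_smul_mem (p := p) (powSpan A p) ((C a + X * C y : R[X]) ^ p).coeff
    (fun t => by
      have h := evalScalar_eq_sum (t : k) _ (Nat.lt_succ_of_le (natDegree_line_pow_le a y p))
      rw [Finset.sum_range_succ, ← sub_eq_iff_eq_add, map_pow, evalScalar_line, hc] at h
      rw [← h]
      exact sub_mem (pow_mem_powSpan (add_mem ha (A.smul_mem _ hy)))
        (Submodule.smul_mem _ _ (pow_mem_powSpan hy))) hp.one_lt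
  have h0 := evalScalar_derivative_line_pow hp hp2 (0 : k) a y
  rw [zero_smul, add_zero, evalScalar_eq_sum (0 : k) _ (Nat.lt_succ_self _),
    Finset.sum_range_succ'] at h0
  simp only [coeff_derivative] at h0
  rw [← h0]
  simpa using h1

open Polynomial in
theorem add_pow_sub_mem_derSpan (hp : p.Prime) (hp2 : 2 < p) [CharP k p] [Nontrivial R] {a y : R}
    (ha : a ∈ A) (hy : y ∈ A) : (a + y) ^ p - a ^ p - y ^ p ∈ derSpan A p := by
  set G : R[X] := (C a + X * C y) ^ p with hG
  have hdeg : G.natDegree ≤ p := natDegree_line_pow_le a y p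
  have hc : G.coeff p = y ^ p := coeff_line_pow a y p
  have hco : ∀ i, i + 1 < p → G.coeff (i + 1) ∈ derSpan A p := by
    intro i hi
    have h := mem_of_sum_pow_smul_mem (p := p) (derSpan A p) (derivative G).coeff
      (fun t => by
        rw [← evalScalar_eq_sum _ _ (lt_of_le_of_lt (natDegree_derivative_le _) (by omega)),
          hG, evalScalar_derivative_line_pow hp hp2]
        exact innerDer_pow_mem_derSpan (add_mem ha (A.smul_mem _ hy)) hy) (Nat.lt_of_succ_lt hi)
    have hne : ((i + 1 : ℕ) : k) ≠ 0 := fun h0 =>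
      Nat.not_dvd_of_pos_of_lt i.succ_pos hi ((CharP.cast_eq_zero_iff k p _).1 h0)
    have e : (derivative G).coeff i = ((i + 1 : ℕ) : k) • G.coeff (i + 1) := by
      rw [coeff_derivative, Algebra.smul_def, map_natCast, Nat.cast_comm]
      push_cast
      rfl
    rw [e] at h
    exact ((derSpan A p).smul_mem_iff hne).1 h
  have e0 := evalScalar_eq_sum (0 : k) G (Nat.lt_succ_of_le hdeg)
  have e1 := evalScalar_eq_sum (1 : k) G (Nat.lt_succ_of_le hdeg)
  rw [hG, map_pow, evalScalar_line, ← hG] at e0 e1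
  obtain ⟨q, rfl⟩ : ∃ q, p = q + 1 := ⟨p - 1, by omega⟩
  rw [Finset.sum_range_succ'] at e0
  rw [Finset.sum_range_succ, Finset.sum_range_succ', hc] at e1
  simp only [zero_smul, add_zero, one_smul, one_pow, pow_zero, ne_eq, Nat.succ_ne_zero,
    not_false_eq_true, zero_pow, Finset.sum_const_zero, zero_add] at e0 e1
  rw [e1, e0, add_sub_right_comm, add_sub_cancel_right, add_sub_cancel_right]
  exact Submodule.sum_mem _ fun i hi => hco i (by simpa using hi)

end PowSpan

section PowSpanPow

variable {k R : Type*} [Field k] [Ring R] [Algebra k R]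
variable {f : R →ₗ[k] k} {A : NonUnitalSubalgebra k R} {W V : Submodule k R} {p : ℕ}

theorem two_ne_zero_of_two_lt_char (hp2 : 2 < p) [CharP k p] : (2 : k) ≠ 0 := by
  have := (CharP.cast_eq_zero_iff k p 2).not.2 (Nat.not_dvd_of_pos_of_lt two_pos hp2)
  exact_mod_cast this

theorem pow_mem_of_ne_zero {a : R} (ha : a ∈ A) {n : ℕ} (hn : n ≠ 0) : a ^ n ∈ A := by
  obtain ⟨n, rfl⟩ := Nat.exists_eq_succ_of_ne_zero hn
  induction n with
  | zero => simpa using ha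
  | succ n ih => rw [pow_succ]; exact mul_mem (ih n.succ_ne_zero) ha

theorem mem_of_mem_powSpan (hp : p ≠ 0) {s : R} (hs : s ∈ powSpan A p) : s ∈ A := by
  refine (Submodule.span_le (p := A.toSubmodule)).2 ?_ hs
  rintro _ ⟨a, ha, rfl⟩
  exact pow_mem_of_ne_zero ha hp

theorem mem_of_mem_derSpan {s : R} (hs : s ∈ derSpan A p) : s ∈ A := by
  refine (Submodule.span_le (p := A.toSubmodule)).2 ?_ hs
  rintro _ ⟨a, ha, y, hy, rfl⟩
  exact innerDer_pow_mem ha hy _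

theorem innerDer_mem_derSpan (hp : p.Prime) [CharP k p] [Nontrivial R] {x s : R}
    (hx : x ∈ A) (hs : s ∈ powSpan A p) : innerDer k x s ∈ derSpan A p := by
  suffices powSpan A p ≤ (derSpan A p).comap (innerDer k x) from this hs
  refine Submodule.span_le.2 ?_
  rintro _ ⟨a, ha, rfl⟩
  have h : innerDer k x (a ^ p) = -(innerDer k a ^ (p - 1)) (innerDer k a x) := by
    rw [← Module.End.mul_apply, ← pow_succ, Nat.sub_add_cancel hp.one_le, innerDer_pow_char hp,
      innerDer_apply, innerDer_apply, neg_sub]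
  change innerDer k x (a ^ p) ∈ derSpan A p
  rw [h]
  exact neg_mem (innerDer_pow_mem_derSpan ha (innerDer_mem ha hx))

theorem isTraceModule_powSpan (hp : p.Prime) (hp2 : 2 < p) [CharP k p] [Nontrivial R]
    (hf : powSpan A p ≤ LinearMap.ker f) : IsTraceModule f A (powSpan A p) where
  mem_of_mem _ hw := mem_of_mem_powSpan hp.ne_zero hw
  der_mem _ ha _ hw := derSpan_le_powSpan hp hp2 (innerDer_mem_derSpan hp ha hw)
  apply_comm _ ha _ hw := by
    have h := hf (derSpan_le_powSpan hp hp2 (innerDer_mem_derSpan hp ha hw))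
    rwa [LinearMap.mem_ker, innerDer_apply, map_sub, sub_eq_zero] at h

namespace IsTraceModule

theorem pow_succ (hW : IsTraceModule f A W) (n : ℕ) : IsTraceModule f A (W ^ (n + 1)) := by
  induction n with
  | zero => simpa using hW
  | succ n ih => rw [_root_.pow_succ]; exact ih.mul hW

theorem mem_of_mem_pow (hW : IsTraceModule f A W) {n : ℕ} (hn : n ≠ 0) {w : R} (hw : w ∈ W ^ n) :
    w ∈ A := by
  obtain ⟨n, rfl⟩ := Nat.exists_eq_succ_of_ne_zero hn
  exact (hW.pow_succ n).mem_of_mem w hw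

theorem apply_comm_pow (hW : IsTraceModule f A W) {n : ℕ} {x w : R} (hx : x ∈ A)
    (hw : w ∈ W ^ n) : f (x * w) = f (w * x) := by
  cases n with
  | zero =>
    rw [pow_zero] at hw
    obtain ⟨r, rfl⟩ := Submodule.mem_one.1 hw
    rw [Algebra.commutes]
  | succ n => exact (hW.pow_succ n).apply_comm x hx w hw

theorem apply_mul_mul_comm (hW : IsTraceModule f A W) (hV : IsTraceModule f A V)
    (hVW : ∀ v ∈ V, ∀ w ∈ W, f (v * w) = 0) {x w v : R} (hx : x ∈ A) (hw : w ∈ W) (hv : v ∈ V) :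
    f (x * (w * v)) = f (x * (v * w)) := by
  have h := hW.apply_mul_der_swap hx (hV.mem_of_mem v hv) hw
  rw [hVW v hv _ (hW.der_mem x hx w hw), innerDer_apply, mul_sub, map_sub] at h
  linear_combination -h

theorem apply_mul_mul_comm_pow (hW : IsTraceModule f A W) (hV : IsTraceModule f A V)
    (hVW : ∀ v ∈ V, ∀ w ∈ W, f (v * w) = 0) (n : ℕ) :
    ∀ x ∈ A, ∀ w ∈ W, ∀ v ∈ V ^ (n + 1), f (x * (w * v)) = f (x * (v * w)) := by
  induction n with
  | zero =>
    intro x hx w hw v hv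
    exact hW.apply_mul_mul_comm hV hVW hx hw (by simpa using hv)
  | succ n ih =>
    intro x hx w hw v hv
    rw [_root_.pow_succ'] at hv
    refine Submodule.mul_induction_on hv (fun s hs u hu => ?_) fun y z hy hz => ?_
    · have hsA := hV.mem_of_mem s hs
      have hwA := hW.mem_of_mem w hw
      have huA := (hV.pow_succ n).mem_of_mem u hu
      have h₁ := ih (x * s) (mul_mem hx hsA) w hw u hu
      have h₂ := (hV.pow_succ n).apply_comm (x * (w * s)) (mul_mem hx (mul_mem hwA hsA)) u hu
      have h₃ := (hV.pow_succ n).apply_comm (x * (s * w)) (mul_mem hx (mul_mem hsA hwA)) u hu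
      have h₄ := hW.apply_mul_mul_comm hV hVW (mul_mem huA hx) hw hs
      simp only [mul_assoc] at *
      rw [h₂, h₄, ← h₃, h₁]
    · rw [mul_add, mul_add, map_add, hy, hz, add_mul, mul_add, map_add]

theorem apply_derSpan_mul (hp : p.Prime) (hp2 : 2 < p) [CharP k p] [Nontrivial R]
    (hW : IsTraceModule f A W) (hV : IsTraceModule f A V)
    (hWV : ∀ x ∈ A, ∀ w ∈ W, ∀ v ∈ V, f (x * (w * v)) = f (x * (v * w)))
    (hf : powSpan A p ≤ LinearMap.ker f) (hfW : powSpan A p * W ≤ LinearMap.ker f)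
    (hfV : powSpan A p * V ≤ LinearMap.ker f) : derSpan A p * (W * V) ≤ LinearMap.ker f := by
  rw [Submodule.mul_le]
  intro s hs u hu
  have h2 : (2 : k) ≠ 0 := two_ne_zero_of_two_lt_char hp2
  have hodd : Odd (p - 2) :=
    Nat.Odd.sub_even hp2.le (hp.odd_of_ne_two (by omega)) even_two
  have hle := derSpan_le_powSpan (A := A) hp hp2
  have hpn : p - 1 = p - 2 + 1 := by omega
  suffices derSpan A p ≤ (LinearMap.ker f).comap (LinearMap.mulRight k u) from this hs
  refine Submodule.span_le.2 ?_
  rintro _ ⟨a, ha, y, hy, rfl⟩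
  change f ((innerDer k a ^ (p - 1)) y * u) = 0
  refine Submodule.mul_induction_on hu (fun w hw v hv => ?_) fun b c hb hc => ?_
  · have hS : ∀ x ∈ A, (innerDer k a ^ (p - 2 + 1)) x ∈ powSpan A p := fun x hx =>
      hle (hpn ▸ innerDer_pow_mem_derSpan ha hx)
    rw [hpn]
    exact hW.apply_der_pow_mul_mul h2 hV hWV hodd ha (fun x hx => hf (hS x hx))
      (fun x hx w hw => hfW (Submodule.mul_mem_mul (hS x hx) hw))
      (fun x hx v hv => hfV (Submodule.mul_mem_mul (hS x hx) hv)) hy hw hv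
  · rw [mul_add, map_add, hb, hc, add_zero]

end IsTraceModule

theorem powSpan_mul_powSpan_le (hp : p.Prime) (hp2 : 2 < p) [CharP k p] [Nontrivial R] :
    powSpan A p * powSpan A p ≤ (powSpan A p ⊓ powSpan A p * powSpan A p) ⊔
      (derSpan A p * powSpan A p ⊔ powSpan A p * derSpan A p) := by
  set T := (powSpan A p ⊓ powSpan A p * powSpan A p) ⊔
      (derSpan A p * powSpan A p ⊔ powSpan A p * derSpan A p) with hT
  have h2 : (2 : k) ≠ 0 := two_ne_zero_of_two_lt_char hp2
  have hsq : ∀ z ∈ A, z ^ p * z ^ p ∈ T := fun z hz => by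
    refine Submodule.mem_sup_left ⟨?_, Submodule.mul_mem_mul (pow_mem_powSpan hz)
      (pow_mem_powSpan hz)⟩
    rw [← (Commute.refl z).mul_pow]
    exact pow_mem_powSpan (mul_mem hz hz)
  conv_lhs => rw [powSpan, Submodule.span_mul_span]
  refine Submodule.span_le.2 ?_
  rintro _ ⟨_, ⟨x, hx, rfl⟩, _, ⟨y, hy, rfl⟩, rfl⟩
  change x ^ p * y ^ p ∈ T
  have hxP : x ^ p ∈ powSpan A p := pow_mem_powSpan hx
  have hyP : y ^ p ∈ powSpan A p := pow_mem_powSpan hy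
  have hcomm : x ^ p * y ^ p - y ^ p * x ^ p ∈ T := by
    refine Submodule.mem_sup_left ⟨?_, sub_mem (Submodule.mul_mem_mul hxP hyP)
      (Submodule.mul_mem_mul hyP hxP)⟩
    rw [← innerDer_apply (k := k)]
    exact derSpan_le_powSpan hp hp2
      (innerDer_mem_derSpan hp (pow_mem_of_ne_zero hx hp.ne_zero) hyP)
  have hs := add_pow_sub_mem_derSpan hp hp2 hx hy
  set s := (x + y) ^ p - x ^ p - y ^ p with hs_def
  have h₁ : s * (x + y) ^ p ∈ T := Submodule.mem_sup_right (Submodule.mem_sup_left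
    (Submodule.mul_mem_mul hs (pow_mem_powSpan (add_mem hx hy))))
  have h₃ : (x ^ p + y ^ p) * s ∈ T := Submodule.mem_sup_right (Submodule.mem_sup_right
    (Submodule.mul_mem_mul (add_mem hxP hyP) hs))
  have h : (2 : k) • (x ^ p * y ^ p) ∈ T := by
    have e : (2 : k) • (x ^ p * y ^ p) = (x + y) ^ p * (x + y) ^ p - x ^ p * x ^ p - y ^ p * y ^ p -
        s * (x + y) ^ p - (x ^ p + y ^ p) * s + (x ^ p * y ^ p - y ^ p * x ^ p) := by
      rw [two_smul, hs_def]
      noncomm_ring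
    rw [e]
    exact add_mem (sub_mem (sub_mem (sub_mem (sub_mem (hsq _ (add_mem hx hy)) (hsq x hx))
      (hsq y hy)) h₁) h₃) hcomm
  exact (T.smul_mem_iff h2).1 h

/-- A functional that is cyclically symmetric for `p`-th powers and kills all products of an
element of `derSpan A p` with `p`-th powers can be tested on products of squares. -/
theorem powSpan_pow_le_ker (hp : p.Prime) (hp2 : 2 < p) [CharP k p] [Nontrivial R]
    (hP : IsTraceModule f A (powSpan A p)) {N c : ℕ} (hc : c ≠ 0)
    (hS : derSpan A p * powSpan A p ^ N ≤ LinearMap.ker f) (b t : ℕ)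
    (hN : 2 * (t + b) + c = N + 1)
    (h : (powSpan A p ⊓ powSpan A p * powSpan A p) ^ (t + b) * powSpan A p ^ c ≤
      LinearMap.ker f) :
    (powSpan A p ⊓ powSpan A p * powSpan A p) ^ t * powSpan A p ^ (2 * b + c) ≤
      LinearMap.ker f := by
  induction b generalizing t with
  | zero => simpa using h
  | succ b ih =>
    have ih := ih (t + 1) (by omega) (by rwa [add_assoc, add_comm 1])
    set P := powSpan A p with hP_def
    set D := P ⊓ P * P with hD_def
    have hD : D ^ t ≤ P ^ (2 * t) := by
      rw [pow_mul, pow_two]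
      exact pow_le_pow_left' inf_le_right t
    rw [show 2 * (b + 1) + c = 2 + (2 * b + c) by ring, pow_add P 2, pow_two, Submodule.mul_le]
    intro d hd v hv
    refine Submodule.mul_induction_on hv (fun u hu e he => ?_) fun y z hy hz => ?_
    · have heA := hP.mem_of_mem_pow (by omega) he
      obtain ⟨g, hg, _, hyz, rfl⟩ := Submodule.mem_sup.1 (powSpan_mul_powSpan_le hp hp2 hu)
      obtain ⟨y, hy, z, hz, rfl⟩ := Submodule.mem_sup.1 hyz
      rw [add_mul, mul_add, add_mul, mul_add]
      refine add_mem ?_ (add_mem ?_ ?_)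
      · rw [← mul_assoc]
        exact ih (Submodule.mul_mem_mul (by rw [pow_succ]; exact Submodule.mul_mem_mul hd hg) he)
      · refine Submodule.mul_induction_on hy (fun s hs q hq => ?_) fun y z hy hz => ?_
        · rw [LinearMap.mem_ker, ← hP.apply_comm_pow (mul_mem (mul_mem (mem_of_mem_derSpan hs)
            (hP.mem_of_mem q hq)) heA) (hD hd), mul_assoc, mul_assoc]
          refine hS (Submodule.mul_mem_mul hs ?_)
          have := Submodule.mul_mem_mul hq (Submodule.mul_mem_mul he (hD hd))
          rwa [← pow_add, ← pow_succ', show 2 * b + c + 2 * t + 1 = N by omega] at this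
        · rw [add_mul, mul_add]
          exact add_mem hy hz
      · refine Submodule.mul_induction_on hz (fun q hq s hs => ?_) fun y z hy hz => ?_
        · have hdq : d * q ∈ P ^ (2 * t + 1) := by
            rw [pow_succ]; exact Submodule.mul_mem_mul (hD hd) hq
          rw [LinearMap.mem_ker, mul_assoc q, ← mul_assoc d,
            ← hP.apply_comm_pow (mul_mem (mem_of_mem_derSpan hs) heA) hdq, mul_assoc]
          refine hS (Submodule.mul_mem_mul hs ?_)
          have := Submodule.mul_mem_mul he hdq
          rwa [← pow_add, show 2 * b + c + (2 * t + 1) = N by omega] at this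
        · rw [add_mul, mul_add]
          exact add_mem hy hz
    · rw [mul_add]
      exact add_mem hy hz

theorem powSpan_pow_one_add_add_le (hp : p.Prime) (hp2 : 2 < p) [CharP k p] [Nontrivial R]
    {a b : ℕ} (hb : b ≠ 0) (hba : b ≤ a) :
    powSpan A p ^ (1 + a + b) ≤ powSpan A p ⊔ powSpan A p ^ (1 + a) ⊔ powSpan A p ^ (1 + b) := by
  intro v hv
  by_contra hv'
  obtain ⟨f, hf, hN⟩ := Submodule.exists_le_ker_of_notMem hv'
  obtain ⟨⟨h1, hfa⟩, hfb⟩ : (_ ∧ _) ∧ _ := by simpa only [sup_le_iff] using hN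
  have hP := isTraceModule_powSpan hp hp2 h1
  obtain ⟨a, rfl⟩ := Nat.exists_eq_add_of_le hba
  obtain ⟨b, rfl⟩ := Nat.exists_eq_succ_of_ne_zero hb
  have hW := hP.pow_succ (b + a)
  have hV := hP.pow_succ b
  rw [show 1 + (b.succ + a) = b + a + 1 + 1 by omega, pow_succ'] at hfa
  rw [add_comm, pow_succ'] at hfb
  have hS := hW.apply_derSpan_mul hp hp2 hV (hW.apply_mul_mul_comm_pow hP
    (fun s hs w hw => hfa (Submodule.mul_mem_mul hs hw)) b) h1 hfa hfb
  rw [← pow_add] at hS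
  have h := powSpan_pow_le_ker hp hp2 hP (c := a + 1) (by omega) hS (b + 1) 0 (by omega) ?_
  · rw [pow_zero, one_mul] at h
    exact hf (h (by convert hv using 2; omega))
  · refine le_trans (mul_le_mul' (pow_le_pow_left' inf_le_left _) le_rfl) ?_
    rw [← pow_succ'] at hfa
    rw [← pow_add]
    convert hfa using 2
    omega

theorem powSpan_pow_add_add_le (hp : p.Prime) (hp2 : 2 < p) [CharP k p] [Nontrivial R]
    {n a b : ℕ} (hn : n ≠ 0) (hb : b ≠ 0) (hba : b ≤ a) :
    powSpan A p ^ (n + a + b) ≤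
      powSpan A p ^ n ⊔ powSpan A p ^ (n + a) ⊔ powSpan A p ^ (n + b) := by
  obtain ⟨n, rfl⟩ := Nat.exists_eq_succ_of_ne_zero hn
  have h := mul_le_mul' (le_refl (powSpan A p ^ n))
    (powSpan_pow_one_add_add_le (A := A) hp hp2 hb hba)
  rw [Submodule.mul_sup, Submodule.mul_sup, ← pow_succ, ← pow_add, ← pow_add, ← pow_add] at h
  simpa only [Nat.succ_eq_add_one, add_assoc] using h

theorem powSpan_pow_add_mul_le (hp : p.Prime) (hp2 : 2 < p) [CharP k p] [Nontrivial R]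
    {n r m : ℕ} (hn : n ≠ 0) (hr : r ≠ 0) (hm : n + r ≤ m) (q : ℕ) :
    powSpan A p ^ (m + q * r) ≤ powSpan A p ^ n ⊔ powSpan A p ^ (n + r) ⊔ powSpan A p ^ m := by
  induction q with
  | zero => simp
  | succ q ih =>
    have h := powSpan_pow_add_add_le (A := A) hp hp2 (a := m + q * r - n) hn hr
      (by have := Nat.zero_le (q * r); omega)
    rw [show n + (m + q * r - n) = m + q * r by have := Nat.zero_le (q * r); omega] at h
    rw [show m + (q + 1) * r = m + q * r + r by ring]
    exact h.trans (sup_le (sup_le (le_sup_left.trans le_sup_left) ih)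
      (le_sup_right.trans le_sup_left))

end PowSpanPow

section Bridge

theorem map_lprod {A B F : Type*} [NonUnitalSemiring A] [NonUnitalSemiring B] [FunLike F A B]
    [NonUnitalRingHomClass F A B] (φ : F) : ∀ l : List A, φ (lprod l) = lprod (l.map φ)
  | [] => map_zero φ
  | [_] => rfl
  | a :: b :: l => by
    rw [lprod, map_mul, map_lprod φ (b :: l), List.map_cons, List.map_cons, List.map_cons, lprod]

theorem map_npow' {A B F : Type*} [NonUnitalSemiring A] [NonUnitalSemiring B] [FunLike F A B]
    [NonUnitalRingHomClass F A B] (φ : F) (a : A) (n : ℕ) : φ (npow' a n) = npow' (φ a) n := by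
  rw [npow', map_lprod, List.map_replicate, npow']

theorem lprod_eq_prod {A : Type*} [Semiring A] : ∀ l : List A, l ≠ [] → lprod l = l.prod
  | [a], _ => List.prod_singleton.symm
  | a :: b :: l, _ => by rw [lprod, lprod_eq_prod (b :: l) (by simp), List.prod_cons (a := a)]

theorem npow'_eq_pow {A : Type*} [Semiring A] (a : A) {n : ℕ} (hn : n ≠ 0) :
    npow' a n = a ^ n := by
  rw [npow', lprod_eq_prod _ (by simpa using hn), List.prod_replicate]

theorem map_hword {k R : Type*} [Field k] [Ring R] [Algebra k R] (φ : FA k →ₙₐ[k] R) {p n : ℕ}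
    (hp : p ≠ 0) (hn : n ≠ 0) :
    φ (hword k p n) = ((List.range n).map fun t => φ (Xg k t) ^ p).prod := by
  rw [hword, map_lprod, lprod_eq_prod _ (by simpa using hn), List.map_map]
  congr 2
  funext t
  rw [Function.comp_apply, map_npow', npow'_eq_pow _ hp]

theorem exists_hom_apply_Xg (k : Type*) [Field k] (y : ℕ → FA k) :
    ∃ φ : FA k →ₙₐ[k] FA k, ∀ t, φ (Xg k t) = y t :=
  ⟨MonoidAlgebra.liftMagma k (FreeSemigroup.lift y), fun t => by
    simp [Xg, MonoidAlgebra.liftMagma_apply_apply]⟩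

variable {k : Type*} [Field k]

/-- The free non-unital algebra as a subalgebra of its unitization. -/
noncomputable abbrev freeRange (k : Type*) [Field k] :
    NonUnitalSubalgebra k (Unitization k (FA k)) :=
  NonUnitalAlgHom.range (Unitization.inrNonUnitalAlgHom k (FA k))

theorem map_TSpan_hword {p : ℕ} (hp : p ≠ 0) {I : Set ℕ} (hI : 0 ∉ I) :
    (TSpan k (hword k p '' I)).map
        (Unitization.inrNonUnitalAlgHom k (FA k) : FA k →ₗ[k] Unitization k (FA k)) =
      ⨆ n ∈ I, powSpan (freeRange k) p ^ n := by
  rw [TSpan, Submodule.map_span]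
  refine le_antisymm (Submodule.span_le.2 ?_) (iSup₂_le fun n hn => ?_)
  · rintro _ ⟨_, ⟨φ, _, ⟨n, hn, rfl⟩, rfl⟩, rfl⟩
    refine (le_iSup₂_of_le (f := fun n (_ : n ∈ I) => powSpan (freeRange k) p ^ n) n hn le_rfl) ?_
    have h := map_hword ((Unitization.inrNonUnitalAlgHom k (FA k)).comp φ) hp
      (ne_of_mem_of_not_mem hn hI)
    change ((Unitization.inrNonUnitalAlgHom k (FA k)).comp φ) (hword k p n) ∈ _
    rw [h]
    clear h hn
    induction n with
    | zero => simp
    | succ n ih =>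
      rw [List.range_succ, List.map_append, List.prod_append, List.map_singleton,
        List.prod_singleton, pow_succ]
      exact Submodule.mul_mem_mul ih (pow_mem_powSpan ⟨_, rfl⟩)
  · rw [powSpan, Submodule.span_pow]
    refine Submodule.span_mono fun x hx => ?_
    obtain ⟨g, rfl⟩ := Set.mem_pow.1 hx
    have hg : ∀ j : Fin n, ∃ b : FA k,
        (Unitization.inrNonUnitalAlgHom k (FA k) b) ^ p = (g j : Unitization k (FA k)) := by
      intro j
      obtain ⟨_, ⟨b, rfl⟩, hb⟩ := (g j).2
      exact ⟨b, hb⟩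
    choose b hb using hg
    obtain ⟨φ, hφ⟩ := exists_hom_apply_Xg k fun t => if h : t < n then b ⟨t, h⟩ else 0
    refine ⟨φ (hword k p n), ⟨φ, _, ⟨n, hn, rfl⟩, rfl⟩, ?_⟩
    have h := map_hword ((Unitization.inrNonUnitalAlgHom k (FA k)).comp φ) hp
      (ne_of_mem_of_not_mem hn hI)
    refine h.trans (congrArg List.prod (List.ext_getElem (by simp) fun t h₁ h₂ => ?_))
    have ht : t < n := by simpa using h₁
    simp [hφ, ht, ← hb]

theorem TSpan_hword_congr {p : ℕ} (hp : p ≠ 0) {I J : Set ℕ} (hI : 0 ∉ I) (hJ : 0 ∉ J)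
    (h : ⨆ n ∈ I, powSpan (freeRange k) p ^ n = ⨆ n ∈ J, powSpan (freeRange k) p ^ n) :
    TSpan k (hword k p '' I) = TSpan k (hword k p '' J) := by
  rw [← map_TSpan_hword hp hI, ← map_TSpan_hword hp hJ] at h
  exact Submodule.map_injective_of_injective (f := (Unitization.inrNonUnitalAlgHom k (FA k) :
    FA k →ₗ[k] Unitization k (FA k))) Unitization.inr_injective h

end Bridge

/-- Every term of a strictly increasing sequence `i` other than `i 0` is congruent modulo
`r` to a smallest such term; these and `i 0` form a set of size at most `r + 1`. -/
theorem exists_finset_residues {i : ℕ → ℕ} (hmono : StrictMono i) {r : ℕ} (hr : r ≠ 0) :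
    ∃ J : Finset ℕ, J.card ≤ r + 1 ∧ (∀ n ∈ J, n ∈ Set.range i) ∧ i 0 ∈ J ∧ i 1 ∈ J ∧
      ∀ j ≠ 0, ∃ n ∈ J, i 1 ≤ n ∧ ∃ q, i j = n + q * r := by
  classical
  let c : ℕ → ℕ := fun ρ => if h : ∃ j, j ≠ 0 ∧ i j % r = ρ then i (Nat.find h) else i 0
  have hc : ∀ j ≠ 0, ∃ l ≠ 0, l ≤ j ∧ i l % r = i j % r ∧ c (i j % r) = i l := by
    intro j hj
    have h : ∃ l, l ≠ 0 ∧ i l % r = i j % r := ⟨j, hj, rfl⟩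
    exact ⟨Nat.find h, (Nat.find_spec h).1, Nat.find_min' h ⟨hj, rfl⟩, (Nat.find_spec h).2,
      dif_pos h⟩
  have hmem : ∀ j, c (i j % r) ∈ insert (i 0) ((Finset.range r).image c) := fun j =>
    Finset.mem_insert_of_mem (Finset.mem_image_of_mem c
      (Finset.mem_range.2 (Nat.mod_lt _ (Nat.pos_of_ne_zero hr))))
  refine ⟨insert (i 0) ((Finset.range r).image c), ?_, ?_, Finset.mem_insert_self _ _, ?_, ?_⟩
  · exact (Finset.card_insert_le _ _).trans
      (Nat.succ_le_succ (Finset.card_image_le.trans (Finset.card_range r).le))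
  · intro n hn
    rcases Finset.mem_insert.1 hn with rfl | hn
    · exact ⟨0, rfl⟩
    · obtain ⟨ρ, -, rfl⟩ := Finset.mem_image.1 hn
      by_cases h : ∃ j, j ≠ 0 ∧ i j % r = ρ
      · exact ⟨Nat.find h, by simp only [c, dif_pos h]⟩
      · exact ⟨0, by simp only [c, dif_neg h]⟩
  · obtain ⟨l, hl0, hl1, -, hl⟩ := hc 1 one_ne_zero
    rw [show l = 1 by omega] at hl
    exact hl ▸ hmem 1
  · intro j hj
    obtain ⟨l, hl0, hlj, hmod, hl⟩ := hc j hj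
    refine ⟨i l, hl ▸ hmem j, hmono.monotone (Nat.one_le_iff_ne_zero.2 hl0), ?_⟩
    have hle := hmono.monotone hlj
    obtain ⟨q, hq⟩ := (Nat.modEq_iff_dvd' hle).1 hmod
    exact ⟨q, by rw [mul_comm, ← hq]; omega⟩

/-- Shchigolev's conjecture: for `p > 2` and any strictly increasing sequence
`i_1 < i_2 < ⋯` of positive integers (`i j` plays the role of `i_{j+1}`), the T-space
generated by `{x_1^p ⋯ x_{i_j}^p : j ≥ 1}` is finitely based, with a T-space basis of
size at most `i_2 - i_1 + 1`. -/
theorem shchigolevs_conjecture (k : Type*) [Field k] (p : ℕ) (hp : p.Prime)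
    (hp2 : 2 < p) [CharP k p] (i : ℕ → ℕ) (hmono : StrictMono i) (hpos : 1 ≤ i 0) :
    ∃ G : Finset (FA k), G.card ≤ i 1 - i 0 + 1 ∧
      TSpan k ↑G = TSpan k {f | ∃ j : ℕ, f = hword k p (i j)} := by
  classical
  have hr : i 1 - i 0 ≠ 0 := Nat.sub_ne_zero_of_lt (hmono Nat.zero_lt_one)
  have h1 : i 0 + (i 1 - i 0) = i 1 := by omega
  obtain ⟨J, hcard, hJ, hJ0, hJ1, hJq⟩ := exists_finset_residues hmono hr
  have hset : {f | ∃ j : ℕ, f = hword k p (i j)} = hword k p '' Set.range i := by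
    ext f
    simp [eq_comm]
  have hI : 0 ∉ Set.range i := by
    rintro ⟨j, hj⟩
    have := hmono.monotone (Nat.zero_le j)
    omega
  refine ⟨J.image (hword k p), Finset.card_image_le.trans hcard, ?_⟩
  rw [hset, Finset.coe_image]
  refine TSpan_hword_congr hp.ne_zero (fun h => hI (hJ 0 h)) hI (le_antisymm ?_ ?_)
  · exact iSup₂_le fun n hn => le_iSup₂_of_le n (hJ n hn) le_rfl
  · have hle : ∀ n ∈ J, powSpan (freeRange k) p ^ n ≤
        ⨆ n ∈ (J : Set ℕ), powSpan (freeRange k) p ^ n := fun n hn => le_iSup₂_of_le n hn le_rfl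
    refine iSup₂_le ?_
    rintro _ ⟨j, rfl⟩
    rcases eq_or_ne j 0 with rfl | hj
    · exact hle _ hJ0
    · obtain ⟨n, hn, hin, q, hq⟩ := hJq j hj
      rw [hq]
      have h := powSpan_pow_add_mul_le (A := freeRange k) hp hp2 (Nat.one_le_iff_ne_zero.1 hpos)
        hr (h1.trans_le hin) q
      rw [h1] at h
      exact h.trans (sup_le (sup_le (hle _ hJ0) (hle _ hJ1)) (hle n hn))
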